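/- Let q ≥ 2, let N^q be the free two-step nilpotent complex Lie algebra on q generators with derived subalgebra V, and let B be the symmetric bilinear form on V for which the basis {⁅u_i, u_j⁆ : 1 ≤ i < j ≤ q} is orthonormal; for a subspace I ⊆ V write I^⊥ = {v ∈ V : B(v,w) = 0 for all w ∈ I}. Then for all subspaces I, J ⊆ V: (i) N^q/I is isomorphic to N^q/(I^⊥)^⊥ as complex Lie algebras; (ii) N^q/I ≅ N^q/J if and only if N^q/I^⊥ ≅ N^q/J^⊥; (iii) if dim(N^q/I) = q + p̄ (equivalently dim I = q(q−1)/2 − p̄), then dim(N^q/I^⊥) = q + dim I. -/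

import Mathlib

/-- The free two-step nilpotent complex Lie algebra on `q` generators: the quotient of the
free Lie algebra on `Fin q` by the third term `⁅L,⁅L,L⁆⁆` of its lower central series. -/
abbrev FreeTwoStepNilpotent (q : ℕ) : Type :=
  FreeLieAlgebra ℂ (Fin q) ⧸
    (LieModule.lowerCentralSeries ℂ (FreeLieAlgebra ℂ (Fin q)) (FreeLieAlgebra ℂ (Fin q)) 2 :
      LieIdeal ℂ (FreeLieAlgebra ℂ (Fin q)))

/-- The images `u₁, …, u_q` of the generators in the free two-step nilpotent Lie algebra. -/
noncomputable def freeTwoStepGen (q : ℕ) (i : Fin q) : FreeTwoStepNilpotent q :=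
  LieSubmodule.Quotient.mk (FreeLieAlgebra.of ℂ i)

structure TwoStepData (q : ℕ) (N : Type) [LieRing N] [LieAlgebra ℂ N] (u : Fin q → N)
    (c : N →ₗ[ℂ] (Fin q → ℂ)) : Prop where
  ex : ∀ f : Fin q → N, ∃ φ : N →ₗ⁅ℂ⁆ N, ∀ i, φ (u i) = f i
  nil : ∀ x y z : N, ⁅⁅x, y⁆, z⁆ = 0
  gen : LieSubalgebra.lieSpan ℂ N (Set.range u) = ⊤
  cu : ∀ i, c (u i) = Pi.single i 1
  cl : ∀ x y : N, c ⁅x, y⁆ = 0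

namespace TwoStepData

section
variable {q : ℕ} {N : Type} [LieRing N] [LieAlgebra ℂ N] {u : Fin q → N}
    {c : N →ₗ[ℂ] (Fin q → ℂ)}

theorem ind (h : TwoStepData q N u c) {P : N → Prop} (hadd : ∀ x y, P x → P y → P (x + y))
    (hsmul : ∀ (a : ℂ) x, P x → P (a • x)) (hu : ∀ i, P (u i)) (hl : ∀ x y : N, P ⁅x, y⁆) (x : N) :
    P x := by
  have hx : x ∈ LieSubalgebra.lieSpan ℂ N (Set.range u) := by rw [h.gen]; trivial
  induction hx using LieSubalgebra.lieSpan_induction with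
  | mem y hy => obtain ⟨i, rfl⟩ := hy; exact hu i
  | zero => simpa using hl 0 0
  | add x y _ _ hx hy => exact hadd x y hx hy
  | smul t x _ hx => exact hsmul t x hx
  | lie x y _ _ _ _ => exact hl x y

theorem hom_ext (h : TwoStepData q N u c) {M : Type} [LieRing M] [LieAlgebra ℂ M]
    (f g : N →ₗ⁅ℂ⁆ M) (hfg : ∀ i, f (u i) = g (u i)) (x : N) : f x = g x := by
  have hx : x ∈ LieSubalgebra.lieSpan ℂ N (Set.range u) := by rw [h.gen]; trivial
  induction hx using LieSubalgebra.lieSpan_induction with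
  | mem y hy => obtain ⟨i, rfl⟩ := hy; exact hfg i
  | zero => simp
  | add x y _ _ hx hy => simp [hx, hy]
  | smul t x _ hx => simp [hx]
  | lie x y _ _ hx hy => simp [hx, hy]

theorem mem_V {N : Type} [LieRing N] [LieAlgebra ℂ N] (x : N) :
    x ∈ LieAlgebra.derivedSeries ℂ N 1 ↔
      x ∈ Submodule.span ℂ {m : N | ∃ y z : N, ⁅y, z⁆ = m} := by
  rw [← LieSubmodule.mem_toSubmodule]
  have : (LieAlgebra.derivedSeries ℂ N 1).toSubmodule =
      Submodule.span ℂ {m : N | ∃ y z : N, ⁅y, z⁆ = m} := by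
    have := LieSubmodule.lieIdeal_oper_eq_linear_span' (R := ℂ) (L := N) (M := N) ⊤ ⊤
    simp only [LieSubmodule.mem_top, true_and] at this
    rw [← this]; rfl
  rw [this]

theorem lie_mem_V {N : Type} [LieRing N] [LieAlgebra ℂ N] (x y : N) :
    ⁅x, y⁆ ∈ LieAlgebra.derivedSeries ℂ N 1 :=
  (mem_V _).2 (Submodule.subset_span ⟨x, y, rfl⟩)

theorem V_ind {N : Type} [LieRing N] [LieAlgebra ℂ N] {P : N → Prop}
    (hadd : ∀ x y, P x → P y → P (x + y))
    (hsmul : ∀ (a : ℂ) x, P x → P (a • x)) (hl : ∀ x y : N, P ⁅x, y⁆) (x : N)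
    (hx : x ∈ LieAlgebra.derivedSeries ℂ N 1) : P x := by
  rw [mem_V] at hx
  induction hx using Submodule.span_induction with
  | mem x h => obtain ⟨y, z, rfl⟩ := h; exact hl y z
  | zero => simpa using hl 0 0
  | add x y _ _ hx hy => exact hadd x y hx hy
  | smul a x _ hx => exact hsmul a x hx

theorem V_central (h : TwoStepData q N u c) (x : N) (hx : x ∈ LieAlgebra.derivedSeries ℂ N 1)
    (y : N) : ⁅x, y⁆ = 0 := by
  refine V_ind (P := fun x => ⁅x, y⁆ = 0) ?_ ?_ ?_ x hx
  · intro x y hx hy; simp [hx, hy]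
  · intro a x hx; simp [hx]
  · intro x z; exact h.nil _ _ _

theorem c_V (h : TwoStepData q N u c) (x : N) (hx : x ∈ LieAlgebra.derivedSeries ℂ N 1) :
    c x = 0 := by
  refine V_ind (P := fun x => c x = 0) ?_ ?_ ?_ x hx
  · intro x y hx hy; simp [hx, hy]
  · intro a x hx; simp [hx]
  · intro x z; exact h.cl _ _

theorem decomp (h : TwoStepData q N u c) (x : N) :
    x - ∑ i, c x i • u i ∈ LieAlgebra.derivedSeries ℂ N 1 := by
  refine h.ind (P := fun x => x - ∑ i, c x i • u i ∈ LieAlgebra.derivedSeries ℂ N 1) ?_ ?_ ?_ ?_ x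
  · intro x y hx hy
    have := add_mem hx hy
    convert this using 1
    simp only [map_add, Pi.add_apply, add_smul, Finset.sum_add_distrib]
    abel
  · intro a x hx
    have := SMulMemClass.smul_mem a hx
    convert this using 1
    simp [smul_sub, Finset.smul_sum, mul_smul]
  · intro i
    simp [h.cu, Pi.single_apply]
  · intro x y
    simpa [h.cl] using lie_mem_V x y

theorem ker_c (h : TwoStepData q N u c) :
    LinearMap.ker c = (LieAlgebra.derivedSeries ℂ N 1).toSubmodule := by
  ext x
  rw [LinearMap.mem_ker, LieSubmodule.mem_toSubmodule]
  refine ⟨fun hx => ?_, h.c_V x⟩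
  simpa [hx] using h.decomp x

theorem range_c (h : TwoStepData q N u c) : LinearMap.range c = ⊤ := by
  rw [LinearMap.range_eq_top]
  intro f
  refine ⟨∑ i, f i • u i, ?_⟩
  ext j
  simp [h.cu, Pi.single_apply]

/-- index type -/
abbrev Pr (q : ℕ) := {p : Fin q × Fin q // p.1 < p.2}

theorem V_span (h : TwoStepData q N u c) (x : N) (hx : x ∈ LieAlgebra.derivedSeries ℂ N 1) :
    x ∈ Submodule.span ℂ (Set.range fun p : Pr q => ⁅u p.1.1, u p.1.2⁆) := by
  refine V_ind (P := fun x => x ∈ Submodule.span ℂ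
    (Set.range fun p : Pr q => ⁅u p.1.1, u p.1.2⁆)) ?_ ?_ ?_ x hx
  · intro x y; exact add_mem
  · intro a x; exact Submodule.smul_mem _ a
  · intro x y
    refine h.ind (P := fun x => ⁅x, y⁆ ∈ Submodule.span ℂ
      (Set.range fun p : Pr q => ⁅u p.1.1, u p.1.2⁆)) ?_ ?_ ?_ ?_ x
    · intro x y hx hy; rw [add_lie]; exact add_mem hx hy
    · intro a x hx; rw [smul_lie]; exact Submodule.smul_mem _ a hx
    · intro i
      refine h.ind (P := fun y => ⁅u i, y⁆ ∈ Submodule.span ℂ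
        (Set.range fun p : Pr q => ⁅u p.1.1, u p.1.2⁆)) ?_ ?_ ?_ ?_ y
      · intro x y hx hy; rw [lie_add]; exact add_mem hx hy
      · intro a x hx; rw [lie_smul]; exact Submodule.smul_mem _ a hx
      · intro j
        rcases lt_trichotomy i j with hij | rfl | hij
        · exact Submodule.subset_span ⟨⟨(i, j), hij⟩, rfl⟩
        · simp
        · rw [← lie_skew]
          exact neg_mem (Submodule.subset_span ⟨⟨(j, i), hij⟩, rfl⟩)
      · intro x y
        rw [← lie_skew, h.nil]; simp
    · intro x z; rw [h.nil]; exact zero_mem _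

theorem finite (h : TwoStepData q N u c) : Module.Finite ℂ N := by
  have h1 : (LinearMap.ker c).FG := by
    have : LinearMap.ker c =
        Submodule.span ℂ (Set.range fun p : Pr q => ⁅u p.1.1, u p.1.2⁆) := by
      rw [h.ker_c]
      apply le_antisymm
      · exact h.V_span
      · rw [Submodule.span_le]
        rintro _ ⟨p, rfl⟩
        exact lie_mem_V _ _
    rw [this]
    exact Submodule.fg_span (Set.finite_range _)
  refine ⟨Submodule.fg_of_fg_map_of_fg_inf_ker c ?_ ?_⟩
  · exact IsNoetherian.noetherian _
  · simpa using h1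

theorem finrank_N (h : TwoStepData q N u c) :
    Module.finrank ℂ N = q + Module.finrank ℂ (LieAlgebra.derivedSeries ℂ N 1) := by
  have := h.finite
  have h1 := LinearMap.finrank_range_add_finrank_ker c
  rw [h.range_c, h.ker_c] at h1
  simp at h1
  exact h1.symm

end

section form
variable {q : ℕ} {N : Type} [LieRing N] [LieAlgebra ℂ N] {u : Fin q → N}
    {c : N →ₗ[ℂ] (Fin q → ℂ)} {B : N →ₗ[ℂ] N →ₗ[ℂ] ℂ}

theorem form_gen
    (hB : ∀ i j k l : Fin q, i < j → k < l →
      B ⁅u i, u j⁆ ⁅u k, u l⁆ = if i = k ∧ j = l then 1 else 0) (i j k l : Fin q) :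
    B ⁅u i, u j⁆ ⁅u k, u l⁆ = (if i = k then 1 else 0) * (if j = l then 1 else 0) -
      (if i = l then 1 else 0) * (if j = k then 1 else 0) := by
  have key : ∀ i j k l : Fin q, i < j →
      B ⁅u i, u j⁆ ⁅u k, u l⁆ = (if i = k then 1 else 0) * (if j = l then 1 else 0) -
      (if i = l then 1 else 0) * (if j = k then 1 else 0) := by
    intro i j k l hij
    rcases lt_trichotomy k l with hkl | rfl | hkl
    · rw [hB i j k l hij hkl]
      have : ¬ (i = l ∧ j = k) := by omega
      by_cases h1 : i = k <;> by_cases h2 : j = l <;> by_cases h3 : i = l <;>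
        by_cases h4 : j = k <;> simp_all
    · simp [mul_comm]

    · rw [← lie_skew (u k) (u l), map_neg, hB i j l k hij hkl]
      have : ¬ (i = k ∧ j = l) := by omega
      by_cases h1 : i = k <;> by_cases h2 : j = l <;> by_cases h3 : i = l <;>
        by_cases h4 : j = k <;> simp_all
  rcases lt_trichotomy i j with hij | rfl | hij
  · exact key i j k l hij
  · simp [mul_comm]
  · rw [← lie_skew, map_neg, LinearMap.neg_apply, key j i k l hij]
    ring

/-- dot product of the generator coordinates -/
noncomputable def D (c : N →ₗ[ℂ] (Fin q → ℂ)) (x y : N) : ℂ := ∑ i, c x i * c y i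

theorem D_add_left (x y z : N) : D c (x + y) z = D c x z + D c y z := by
  simp [D, add_mul, Finset.sum_add_distrib]
theorem D_add_right (x y z : N) : D c z (x + y) = D c z x + D c z y := by
  simp [D, mul_add, Finset.sum_add_distrib]
theorem D_smul_left (a : ℂ) (x z : N) : D c (a • x) z = a * D c x z := by
  simp [D, Finset.mul_sum, mul_assoc]
theorem D_smul_right (a : ℂ) (x z : N) : D c z (a • x) = a * D c z x := by
  simp only [D, Finset.mul_sum, map_smul, Pi.smul_apply, smul_eq_mul]
  exact Finset.sum_congr rfl fun i _ => by ring
theorem D_V_left (h : TwoStepData q N u c) (x y z : N) : D c ⁅x, y⁆ z = 0 := by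
  simp [D, h.cl]
theorem D_V_right (h : TwoStepData q N u c) (x y z : N) : D c z ⁅x, y⁆ = 0 := by
  simp [D, h.cl]
theorem D_u_left (h : TwoStepData q N u c) (i : Fin q) (z : N) : D c (u i) z = c z i := by
  simp [D, h.cu, Pi.single_apply]
theorem D_u_right (h : TwoStepData q N u c) (i : Fin q) (z : N) : D c z (u i) = c z i := by
  simp [D, h.cu, Pi.single_apply]

theorem lie_V (h : TwoStepData q N u c) (x y z : N) : ⁅x, ⁅y, z⁆⁆ = 0 := by
  rw [← lie_skew, h.nil, neg_zero]

theorem form (h : TwoStepData q N u c)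
    (hB : ∀ i j k l : Fin q, i < j → k < l →
      B ⁅u i, u j⁆ ⁅u k, u l⁆ = if i = k ∧ j = l then 1 else 0) (x y z w : N) :
    B ⁅x, y⁆ ⁅z, w⁆ = D c x z * D c y w - D c x w * D c y z := by
  refine h.ind (P := fun x => B ⁅x, y⁆ ⁅z, w⁆ = D c x z * D c y w - D c x w * D c y z)
    ?_ ?_ ?_ ?_ x
  · intro x x' h1 h2
    simp only [add_lie, map_add, LinearMap.add_apply, h1, h2, D_add_left]; ring
  · intro a x h1
    simp only [smul_lie, map_smul, LinearMap.smul_apply, h1, D_smul_left, smul_eq_mul]; ring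
  swap
  · intro x x'
    simp [h.nil, h.D_V_left]
  intro i
  refine h.ind (P := fun y => B ⁅u i, y⁆ ⁅z, w⁆ = D c (u i) z * D c y w - D c (u i) w * D c y z)
    ?_ ?_ ?_ ?_ y
  · intro x x' h1 h2
    simp only [lie_add, map_add, LinearMap.add_apply, h1, h2, D_add_left]; ring
  · intro a x h1
    simp only [lie_smul, map_smul, LinearMap.smul_apply, h1, D_smul_left, smul_eq_mul]; ring
  swap
  · intro x x'
    simp [h.lie_V, h.D_V_left]
  intro j
  refine h.ind (P := fun z => B ⁅u i, u j⁆ ⁅z, w⁆ =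
    D c (u i) z * D c (u j) w - D c (u i) w * D c (u j) z) ?_ ?_ ?_ ?_ z
  · intro x x' h1 h2
    simp only [add_lie, map_add, h1, h2, D_add_right]; ring
  · intro a x h1
    simp only [smul_lie, map_smul, h1, D_smul_right, smul_eq_mul]; ring
  swap
  · intro x x'
    simp [h.nil, h.D_V_right]
  intro k
  refine h.ind (P := fun w => B ⁅u i, u j⁆ ⁅u k, w⁆ =
    D c (u i) (u k) * D c (u j) w - D c (u i) w * D c (u j) (u k)) ?_ ?_ ?_ ?_ w
  · intro x x' h1 h2
    simp only [lie_add, map_add, h1, h2, D_add_right]; ring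
  · intro a x h1
    simp only [lie_smul, map_smul, h1, D_smul_right, smul_eq_mul]; ring
  swap
  · intro x x'
    simp [h.lie_V, h.D_V_right]
  intro l
  rw [form_gen hB]
  simp only [h.D_u_left, h.cu, Pi.single_apply]

theorem nondeg (h : TwoStepData q N u c)
    (hB : ∀ i j k l : Fin q, i < j → k < l →
      B ⁅u i, u j⁆ ⁅u k, u l⁆ = if i = k ∧ j = l then 1 else 0) (v : N)
    (hv : v ∈ LieAlgebra.derivedSeries ℂ N 1)
    (hv0 : ∀ w ∈ LieAlgebra.derivedSeries ℂ N 1, B v w = 0) : v = 0 := by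
  have h1 := h.V_span v hv
  rw [Submodule.mem_span_range_iff_exists_fun] at h1
  obtain ⟨a, rfl⟩ := h1
  refine Finset.sum_eq_zero fun p _ => ?_
  have h2 := hv0 ⁅u p.1.1, u p.1.2⁆ (lie_mem_V _ _)
  have h3 : ∀ r : Pr q, B ⁅u r.1.1, u r.1.2⁆ ⁅u p.1.1, u p.1.2⁆ = if r = p then 1 else 0 := by
    intro r
    rw [hB _ _ _ _ r.2 p.2]
    simp [Subtype.ext_iff, Prod.ext_iff]
  simp only [map_sum, map_smul, LinearMap.sum_apply, LinearMap.smul_apply, h3] at h2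
  simp at h2
  simp [h2]

/-- the form on V -/
noncomputable def BV (B : N →ₗ[ℂ] N →ₗ[ℂ] ℂ) :
    LinearMap.BilinForm ℂ (LieAlgebra.derivedSeries ℂ N 1).toSubmodule :=
  LinearMap.BilinForm.restrict B _

theorem BV_nondeg (h : TwoStepData q N u c)
    (hB : ∀ i j k l : Fin q, i < j → k < l →
      B ⁅u i, u j⁆ ⁅u k, u l⁆ = if i = k ∧ j = l then 1 else 0)
    (hs : (BV B).IsRefl) : (BV B).Nondegenerate := by
  refine (LinearMap.IsRefl.nondegenerate_iff_separatingLeft hs).2 ?_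
  intro v hv
  apply Subtype.ext
  exact h.nondeg hB v.1 v.2 fun w hw => hv ⟨w, hw⟩

theorem comap_orth (hs : (BV B).IsRefl) {I Ip : LieIdeal ℂ N}
    (hI : I ≤ LieAlgebra.derivedSeries ℂ N 1)
    (hIp : ∀ v, v ∈ Ip ↔ v ∈ LieAlgebra.derivedSeries ℂ N 1 ∧ ∀ w ∈ I, B v w = 0) :
    (BV B).orthogonal (I.toSubmodule.comap (LieAlgebra.derivedSeries ℂ N 1).toSubmodule.subtype) =
      Ip.toSubmodule.comap (LieAlgebra.derivedSeries ℂ N 1).toSubmodule.subtype := by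
  ext v
  simp only [LinearMap.BilinForm.mem_orthogonal_iff, Submodule.mem_comap, Submodule.subtype_apply,
    LieSubmodule.mem_toSubmodule, hIp]
  constructor
  · intro H
    exact ⟨v.2, fun w hw => hs ⟨w, hI hw⟩ v (H ⟨w, hI hw⟩ hw)⟩
  · intro H w hw
    exact hs v w (H.2 w.1 hw)

theorem dbl (h : TwoStepData q N u c)
    (hB : ∀ i j k l : Fin q, i < j → k < l →
      B ⁅u i, u j⁆ ⁅u k, u l⁆ = if i = k ∧ j = l then 1 else 0)
    (hs : (BV B).IsRefl) {I Ip : LieIdeal ℂ N}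
    (hI : I ≤ LieAlgebra.derivedSeries ℂ N 1)
    (hIp : ∀ v, v ∈ Ip ↔ v ∈ LieAlgebra.derivedSeries ℂ N 1 ∧ ∀ w ∈ I, B v w = 0) (v : N) :
    v ∈ I ↔ v ∈ LieAlgebra.derivedSeries ℂ N 1 ∧ ∀ w ∈ Ip, B v w = 0 := by
  have := h.finite
  have hIpV : Ip ≤ LieAlgebra.derivedSeries ℂ N 1 := fun v hv => ((hIp v).1 hv).1
  have h1 := LinearMap.BilinForm.orthogonal_orthogonal (h.BV_nondeg hB hs) hs
    (I.toSubmodule.comap (LieAlgebra.derivedSeries ℂ N 1).toSubmodule.subtype)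
  rw [comap_orth hs hI hIp] at h1
  have h2 : ∀ v : (LieAlgebra.derivedSeries ℂ N 1).toSubmodule, v.1 ∈ I ↔ 
      ∀ w : (LieAlgebra.derivedSeries ℂ N 1).toSubmodule, w.1 ∈ Ip → B w.1 v.1 = 0 := by
    intro v
    have h3 := SetLike.ext_iff.1 h1 v
    simp only [LinearMap.BilinForm.mem_orthogonal_iff, Submodule.mem_comap,
      Submodule.subtype_apply, LieSubmodule.mem_toSubmodule] at h3
    exact h3.symm
  constructor
  · intro hv
    exact ⟨hI hv, fun w hw => hs ⟨w, hIpV hw⟩ ⟨v, hI hv⟩ ((h2 ⟨v, hI hv⟩).1 hv ⟨w, hIpV hw⟩ hw)⟩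
  · rintro ⟨hv, H⟩
    exact (h2 ⟨v, hv⟩).2 fun w hw => hs ⟨v, hv⟩ w (H w.1 hw)

theorem finrank_Ip (h : TwoStepData q N u c)
    (hB : ∀ i j k l : Fin q, i < j → k < l →
      B ⁅u i, u j⁆ ⁅u k, u l⁆ = if i = k ∧ j = l then 1 else 0)
    (hs : (BV B).IsRefl) {I Ip : LieIdeal ℂ N}
    (hI : I ≤ LieAlgebra.derivedSeries ℂ N 1)
    (hIp : ∀ v, v ∈ Ip ↔ v ∈ LieAlgebra.derivedSeries ℂ N 1 ∧ ∀ w ∈ I, B v w = 0) :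
    Module.finrank ℂ (N ⧸ Ip) = q + Module.finrank ℂ I := by
  have := h.finite
  have hIpV : Ip ≤ LieAlgebra.derivedSeries ℂ N 1 := fun v hv => ((hIp v).1 hv).1
  have h1 := LinearMap.BilinForm.finrank_orthogonal (h.BV_nondeg hB hs)
    (I.toSubmodule.comap (LieAlgebra.derivedSeries ℂ N 1).toSubmodule.subtype)
  rw [comap_orth hs hI hIp,
    (Submodule.comapSubtypeEquivOfLe (p := Ip.toSubmodule) hIpV).finrank_eq,
    (Submodule.comapSubtypeEquivOfLe (p := I.toSubmodule) hI).finrank_eq] at h1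
  have h2 : Module.finrank ℂ I.toSubmodule ≤
    Module.finrank ℂ (LieAlgebra.derivedSeries ℂ N 1).toSubmodule := Submodule.finrank_mono hI
  have h3 := Submodule.finrank_quotient_add_finrank Ip.toSubmodule
  have h4 := h.finrank_N
  change Module.finrank ℂ (N ⧸ Ip.toSubmodule) = q + Module.finrank ℂ I.toSubmodule
  change _ = _ + Module.finrank ℂ (LieAlgebra.derivedSeries ℂ N 1).toSubmodule at h4
  omega

end form

section iso
variable {q : ℕ} {N : Type} [LieRing N] [LieAlgebra ℂ N] {u : Fin q → N}
    {c : N →ₗ[ℂ] (Fin q → ℂ)} {B : N →ₗ[ℂ] N →ₗ[ℂ] ℂ}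

/-- quotient map -/
def qmk (I : LieIdeal ℂ N) : N →ₗ⁅ℂ⁆ N ⧸ I :=
  { I.toSubmodule.mkQ with map_lie' := fun {_ _} => rfl }

theorem qmk_surj (I : LieIdeal ℂ N) : Function.Surjective (qmk I) := Quot.mk_surjective

theorem qmk_zero (I : LieIdeal ℂ N) (x : N) : qmk I x = 0 ↔ x ∈ I :=
  Submodule.Quotient.mk_eq_zero I.toSubmodule

/-- descend to the quotient -/
def qlift {M : Type} [LieRing M] [LieAlgebra ℂ M] (I : LieIdeal ℂ N) (f : N →ₗ⁅ℂ⁆ M)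
    (hf : ∀ x ∈ I, f x = 0) : (N ⧸ I) →ₗ⁅ℂ⁆ M :=
  { I.toSubmodule.liftQ (f : N →ₗ[ℂ] M) hf with
    map_lie' := by
      intro x y
      obtain ⟨x, rfl⟩ := qmk_surj I x
      obtain ⟨y, rfl⟩ := qmk_surj I y
      exact f.map_lie x y }

theorem qlift_qmk {M : Type} [LieRing M] [LieAlgebra ℂ M] (I : LieIdeal ℂ N) (f : N →ₗ⁅ℂ⁆ M)
    (hf : ∀ x ∈ I, f x = 0) (x : N) : qlift I f hf (qmk I x) = f x := rfl

theorem equiv_of (I J : LieIdeal ℂ N) (f g : N →ₗ⁅ℂ⁆ N) (hf : ∀ x ∈ I, f x ∈ J)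
    (hg : ∀ x ∈ J, g x ∈ I) (hfg : ∀ x, f (g x) = x) (hgf : ∀ x, g (f x) = x) :
    Nonempty ((N ⧸ I) ≃ₗ⁅ℂ⁆ (N ⧸ J)) := by
  let F := qlift I ((qmk J).comp f) (fun x hx => (qmk_zero J _).2 (hf x hx))
  let G := qlift J ((qmk I).comp g) (fun x hx => (qmk_zero I _).2 (hg x hx))
  refine ⟨{ F with
    invFun := G
    left_inv := ?_
    right_inv := ?_ }⟩
  · intro x
    obtain ⟨x, rfl⟩ := qmk_surj I x
    change qmk I (g (f x)) = _
    rw [hgf]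
  · intro x
    obtain ⟨x, rfl⟩ := qmk_surj J x
    change qmk J (f (g x)) = _
    rw [hfg]

theorem lift_hom (h : TwoStepData q N u c) {I J : LieIdeal ℂ N} (e : (N ⧸ I) →ₗ⁅ℂ⁆ (N ⧸ J)) :
    ∃ φ : N →ₗ⁅ℂ⁆ N, ∀ x, qmk J (φ x) = e (qmk I x) := by
  choose f hf using fun i => qmk_surj J (e (qmk I (u i)))
  obtain ⟨φ, hφ⟩ := h.ex f
  refine ⟨φ, fun x => ?_⟩
  exact h.hom_ext ((qmk J).comp φ) (e.comp (qmk I)) (fun i => by simp [hφ, hf]) x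

/-- transposed homomorphism -/
theorem transp (h : TwoStepData q N u c) (φ : N →ₗ⁅ℂ⁆ N) :
    ∃ φ' : N →ₗ⁅ℂ⁆ N, (∀ k, φ' (u k) = ∑ j, c (φ (u j)) k • u j) ∧
      ∀ x y, D c (φ x) y = D c x (φ' y) := by
  obtain ⟨φ', hφ'⟩ := h.ex (fun k => ∑ j, c (φ (u j)) k • u j)
  refine ⟨φ', hφ', fun x y => ?_⟩
  refine h.ind (P := fun x => D c (φ x) y = D c x (φ' y)) ?_ ?_ ?_ ?_ x
  · intro x x' h1 h2; simp only [map_add, D_add_left, h1, h2]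
  · intro a x h1; simp only [map_smul, D_smul_left, h1]
  · intro i
    refine h.ind (P := fun y => D c (φ (u i)) y = D c (u i) (φ' y)) ?_ ?_ ?_ ?_ y
    · intro x x' h1 h2; simp only [map_add, D_add_right, h1, h2]
    · intro a x h1; simp only [map_smul, D_smul_right, h1]
    · intro k
      rw [h.D_u_left, h.D_u_right, hφ']
      simp [h.cu, Pi.single_apply]
    · intro x z
      rw [LieHom.map_lie, h.D_V_right, h.D_V_right]
  · intro x z
    rw [LieHom.map_lie, h.D_V_left, h.D_V_left]

theorem transp_inv (h : TwoStepData q N u c) {φ ψ φ' ψ' : N →ₗ⁅ℂ⁆ N}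
    (hc : ∀ x, c (ψ (φ x)) = c x)
    (h1 : ∀ k, φ' (u k) = ∑ j, c (φ (u j)) k • u j)
    (h2 : ∀ k, ψ' (u k) = ∑ j, c (ψ (u j)) k • u j)
    (h3 : ∀ x y, D c (φ x) y = D c x (φ' y))
    (h4 : ∀ x y, D c (ψ x) y = D c x (ψ' y)) (x : N) : φ' (ψ' x) = x := by
  refine h.hom_ext (φ'.comp ψ') LieHom.id (fun i => ?_) x
  change φ' (ψ' (u i)) = u i
  have h5 : φ' (ψ' (u i)) = ∑ k, c (φ' (ψ' (u i))) k • u k := by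
    rw [h2]
    simp only [map_sum, map_smul, h1]
    simp [h.cu, Pi.single_apply, Finset.sum_apply, Finset.smul_sum, smul_smul,
      Finset.sum_smul]
    rw [Finset.sum_comm]
  rw [h5]
  have h6 : ∀ k, c (φ' (ψ' (u i))) k = if k = i then 1 else 0 := by
    intro k
    rw [← h.D_u_left, ← h3, ← h4, h.D_u_right, hc, h.cu, Pi.single_apply]
    simp [eq_comm]
  simp [h6]

theorem adj (h : TwoStepData q N u c)
    (hB : ∀ i j k l : Fin q, i < j → k < l →
      B ⁅u i, u j⁆ ⁅u k, u l⁆ = if i = k ∧ j = l then 1 else 0) {φ φ' : N →ₗ⁅ℂ⁆ N}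
    (h3 : ∀ x y, D c (φ x) y = D c x (φ' y)) (v w : N)
    (hv : v ∈ LieAlgebra.derivedSeries ℂ N 1) (hw : w ∈ LieAlgebra.derivedSeries ℂ N 1) :
    B (φ v) w = B v (φ' w) := by
  refine V_ind (P := fun v => B (φ v) w = B v (φ' w)) ?_ ?_ ?_ v hv
  · intro x y hx hy; simp [hx, hy]
  · intro a x hx; simp [hx]
  intro x y
  refine V_ind (P := fun w => B (φ ⁅x, y⁆) w = B ⁅x, y⁆ (φ' w)) ?_ ?_ ?_ w hw
  · intro x y hx hy; simp only [map_add, hx, hy]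
  · intro a x hx; simp only [map_smul, hx]
  intro z w
  rw [LieHom.map_lie, LieHom.map_lie, h.form hB, h.form hB]
  simp only [h3]

theorem hom_V (φ : N →ₗ⁅ℂ⁆ N) (v : N)
    (hv : v ∈ LieAlgebra.derivedSeries ℂ N 1) : φ v ∈ LieAlgebra.derivedSeries ℂ N 1 := by
  refine V_ind (P := fun v => φ v ∈ LieAlgebra.derivedSeries ℂ N 1) ?_ ?_ ?_ v hv
  · intro x y hx hy; rw [map_add]; exact add_mem hx hy
  · intro a x hx; rw [map_smul]; exact SMulMemClass.smul_mem a hx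
  · intro x y; rw [LieHom.map_lie]; exact lie_mem_V _ _

theorem dual_iso (h : TwoStepData q N u c)
    (hB : ∀ i j k l : Fin q, i < j → k < l →
      B ⁅u i, u j⁆ ⁅u k, u l⁆ = if i = k ∧ j = l then 1 else 0)
    (hs : ∀ v ∈ LieAlgebra.derivedSeries ℂ N 1, ∀ w ∈ LieAlgebra.derivedSeries ℂ N 1,
      B v w = B w v)
    {I J Ip Jp : LieIdeal ℂ N}
    (hI : I ≤ LieAlgebra.derivedSeries ℂ N 1) (hJ : J ≤ LieAlgebra.derivedSeries ℂ N 1)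
    (hIp : ∀ v, v ∈ Ip ↔ v ∈ LieAlgebra.derivedSeries ℂ N 1 ∧ ∀ w ∈ I, B v w = 0)
    (hJp : ∀ v, v ∈ Jp ↔ v ∈ LieAlgebra.derivedSeries ℂ N 1 ∧ ∀ w ∈ J, B v w = 0)
    (e : (N ⧸ I) ≃ₗ⁅ℂ⁆ (N ⧸ J)) : Nonempty ((N ⧸ Ip) ≃ₗ⁅ℂ⁆ (N ⧸ Jp)) := by
  obtain ⟨φ, hφ⟩ := h.lift_hom (e : (N ⧸ I) →ₗ⁅ℂ⁆ (N ⧸ J))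
  obtain ⟨ψ, hψ⟩ := h.lift_hom (e.symm : (N ⧸ J) →ₗ⁅ℂ⁆ (N ⧸ I))
  have hφI : ∀ x ∈ I, φ x ∈ J := by
    intro x hx
    rw [← qmk_zero, hφ, (qmk_zero I x).2 hx, map_zero]
  have hψJ : ∀ x ∈ J, ψ x ∈ I := by
    intro x hx
    rw [← qmk_zero, hψ, (qmk_zero J x).2 hx, map_zero]
  have c1 : ∀ x, c (ψ (φ x)) = c x := by
    intro x
    rw [← sub_eq_zero, ← map_sub]
    refine h.c_V _ (hI ?_)
    rw [← qmk_zero, map_sub, hψ, hφ]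
    simp
  have c2 : ∀ x, c (φ (ψ x)) = c x := by
    intro x
    rw [← sub_eq_zero, ← map_sub]
    refine h.c_V _ (hJ ?_)
    rw [← qmk_zero, map_sub, hφ, hψ]
    simp
  obtain ⟨φ', a1, a2⟩ := h.transp φ
  obtain ⟨ψ', b1, b2⟩ := h.transp ψ
  refine equiv_of Ip Jp ψ' φ' ?_ ?_ (h.transp_inv c2 b1 a1 b2 a2) (h.transp_inv c1 a1 b1 a2 b2)
  · intro x hx
    rw [hIp] at hx
    rw [hJp]
    refine ⟨hom_V _ _ hx.1, fun w hw => ?_⟩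
    rw [hs _ (hom_V _ _ hx.1) _ (hJ hw), ← h.adj hB b2 w x (hJ hw) hx.1,
      hs _ (hom_V _ _ (hJ hw)) _ hx.1]
    exact hx.2 _ (hψJ w hw)
  · intro x hx
    rw [hJp] at hx
    rw [hIp]
    refine ⟨hom_V _ _ hx.1, fun w hw => ?_⟩
    rw [hs _ (hom_V _ _ hx.1) _ (hI hw), ← h.adj hB a2 w x (hI hw) hx.1,
      hs _ (hom_V _ _ (hI hw)) _ hx.1]
    exact hx.2 _ (hφI w hw)

end iso
end TwoStepData

theorem lcs2_zero {q : ℕ} {M : Type} [LieRing M] [LieAlgebra ℂ M]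
    (hM : ∀ x y z : M, ⁅x, ⁅y, z⁆⁆ = 0) (F : FreeLieAlgebra ℂ (Fin q) →ₗ⁅ℂ⁆ M) :
    ∀ x ∈ (LieModule.lowerCentralSeries ℂ (FreeLieAlgebra ℂ (Fin q)) (FreeLieAlgebra ℂ (Fin q)) 2 :
      LieIdeal ℂ (FreeLieAlgebra ℂ (Fin q))), F x = 0 := by
  intro x hx
  have h1 : (LieModule.lowerCentralSeries ℂ (FreeLieAlgebra ℂ (Fin q)) (FreeLieAlgebra ℂ (Fin q)) 2 :
      LieIdeal ℂ (FreeLieAlgebra ℂ (Fin q))) ≤ F.ker := by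
    rw [LieModule.lowerCentralSeries_succ, LieSubmodule.lieIdeal_oper_eq_span,
      LieSubmodule.lieSpan_le]
    rintro _ ⟨⟨a, _⟩, ⟨b, hb⟩, rfl⟩
    simp only [SetLike.mem_coe, LieHom.mem_ker]
    rw [LieHom.map_lie]
    rw [LieModule.lowerCentralSeries_succ, ← LieSubmodule.mem_toSubmodule,
      LieSubmodule.lieIdeal_oper_eq_linear_span'] at hb
    change ⁅F a, F b⁆ = 0
    induction hb using Submodule.span_induction with
    | mem x h => obtain ⟨y, -, z, -, rfl⟩ := h; rw [LieHom.map_lie]; exact hM _ _ _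
    | zero => simp
    | add x y _ _ hx hy => simp [hx, hy]
    | smul a x _ hx => simp [hx]
  exact LieHom.mem_ker.1 (h1 hx)

theorem free_nil (q : ℕ) (x y z : FreeTwoStepNilpotent q) : ⁅x, ⁅y, z⁆⁆ = 0 := by
  obtain ⟨x, rfl⟩ := TwoStepData.qmk_surj _ x
  obtain ⟨y, rfl⟩ := TwoStepData.qmk_surj _ y
  obtain ⟨z, rfl⟩ := TwoStepData.qmk_surj _ z
  rw [← LieHom.map_lie, ← LieHom.map_lie, TwoStepData.qmk_zero]
  rw [LieModule.lowerCentralSeries_succ]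
  refine LieSubmodule.lie_mem_lie (LieSubmodule.mem_top _) ?_
  rw [LieModule.lowerCentralSeries_succ]
  exact LieSubmodule.lie_mem_lie (LieSubmodule.mem_top _) (LieSubmodule.mem_top _)

theorem free_ex {q : ℕ} {M : Type} [LieRing M] [LieAlgebra ℂ M]
    (hM : ∀ x y z : M, ⁅x, ⁅y, z⁆⁆ = 0) (f : Fin q → M) :
    ∃ φ : FreeTwoStepNilpotent q →ₗ⁅ℂ⁆ M, ∀ i, φ (freeTwoStepGen q i) = f i :=
  ⟨TwoStepData.qlift _ (FreeLieAlgebra.lift ℂ f) (lcs2_zero hM _), fun i =>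
    (TwoStepData.qlift_qmk _ _ _ _).trans (FreeLieAlgebra.lift_of_apply f i)⟩

theorem free_gen (q : ℕ) :
    LieSubalgebra.lieSpan ℂ (FreeTwoStepNilpotent q) (Set.range (freeTwoStepGen q)) = ⊤ := by
  rw [eq_top_iff]
  intro x _
  set T := LieSubalgebra.lieSpan ℂ (FreeTwoStepNilpotent q) (Set.range (freeTwoStepGen q)) with hT
  obtain ⟨x, rfl⟩ := TwoStepData.qmk_surj _ x
  let F : FreeLieAlgebra ℂ (Fin q) →ₗ⁅ℂ⁆ T := FreeLieAlgebra.lift ℂ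
    (fun i => ⟨freeTwoStepGen q i, LieSubalgebra.subset_lieSpan ⟨i, rfl⟩⟩)
  have h : T.incl.comp F = TwoStepData.qmk _ := by
    apply FreeLieAlgebra.hom_ext
    intro i
    simp only [LieHom.comp_apply, F, FreeLieAlgebra.lift_of_apply]
    rfl
  rw [← h]
  exact (F x).2

theorem free_data (q : ℕ) :
    ∃ c, TwoStepData q (FreeTwoStepNilpotent q) (freeTwoStepGen q) c := by
  letI : LieRing (Fin q → ℂ) := LieRing.ofAssociativeRing
  letI : LieAlgebra ℂ (Fin q → ℂ) := LieAlgebra.ofAssociativeAlgebra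
  have h0 : ∀ x y : Fin q → ℂ, ⁅x, y⁆ = 0 := fun x y => by
    rw [LieRing.of_associative_ring_bracket, mul_comm, sub_self]
  obtain ⟨c, hc⟩ := free_ex (q := q) (M := Fin q → ℂ) (fun x y z => h0 _ _)
    (fun i => Pi.single i 1)
  refine ⟨(c : FreeTwoStepNilpotent q →ₗ[ℂ] (Fin q → ℂ)), ?_, ?_, free_gen q, hc, ?_⟩
  · exact free_ex (free_nil q)
  · intro x y z
    rw [← lie_skew, free_nil, neg_zero]
  · intro x y
    exact (c.map_lie x y).trans (h0 _ _)

/-- Gauger's duality for the free two-step nilpotent complex Lie algebra `N^q` (`q ≥ 2`) with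
derived subalgebra `V`: given a bilinear form `B` which is symmetric on `V` and makes the basis
`{⁅u_i,u_j⁆ : i < j}` of `V` orthonormal, and ideals `I, J ≤ V` with respective orthogonal
complements `Ip, Jp` inside `V` (and `Ipp` the complement of `Ip`), one has
(i) `N^q/I ≅ N^q/(I^⊥)^⊥`, (ii) `N^q/I ≅ N^q/J ↔ N^q/I^⊥ ≅ N^q/J^⊥`, and
(iii) if `dim (N^q/I) = q + p̄` then `dim (N^q/I^⊥) = q + dim I`. -/
theorem stmt1 (q : ℕ) (hq : 2 ≤ q)
    (B : FreeTwoStepNilpotent q →ₗ[ℂ] FreeTwoStepNilpotent q →ₗ[ℂ] ℂ)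
    (hBsymm : ∀ v ∈ LieAlgebra.derivedSeries ℂ (FreeTwoStepNilpotent q) 1,
      ∀ w ∈ LieAlgebra.derivedSeries ℂ (FreeTwoStepNilpotent q) 1, B v w = B w v)
    (hBorth : ∀ i j k l : Fin q, i < j → k < l →
      B ⁅freeTwoStepGen q i, freeTwoStepGen q j⁆ ⁅freeTwoStepGen q k, freeTwoStepGen q l⁆ =
        if i = k ∧ j = l then 1 else 0)
    (I J Ip Jp Ipp : LieIdeal ℂ (FreeTwoStepNilpotent q))
    (hI : I ≤ LieAlgebra.derivedSeries ℂ (FreeTwoStepNilpotent q) 1)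
    (hJ : J ≤ LieAlgebra.derivedSeries ℂ (FreeTwoStepNilpotent q) 1)
    (hIp : ∀ v, v ∈ Ip ↔
      v ∈ LieAlgebra.derivedSeries ℂ (FreeTwoStepNilpotent q) 1 ∧ ∀ w ∈ I, B v w = 0)
    (hJp : ∀ v, v ∈ Jp ↔
      v ∈ LieAlgebra.derivedSeries ℂ (FreeTwoStepNilpotent q) 1 ∧ ∀ w ∈ J, B v w = 0)
    (hIpp : ∀ v, v ∈ Ipp ↔
      v ∈ LieAlgebra.derivedSeries ℂ (FreeTwoStepNilpotent q) 1 ∧ ∀ w ∈ Ip, B v w = 0) :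
    Nonempty ((FreeTwoStepNilpotent q ⧸ I) ≃ₗ⁅ℂ⁆ (FreeTwoStepNilpotent q ⧸ Ipp)) ∧
    (Nonempty ((FreeTwoStepNilpotent q ⧸ I) ≃ₗ⁅ℂ⁆ (FreeTwoStepNilpotent q ⧸ J)) ↔
      Nonempty ((FreeTwoStepNilpotent q ⧸ Ip) ≃ₗ⁅ℂ⁆ (FreeTwoStepNilpotent q ⧸ Jp))) ∧
    (∀ pbar : ℕ, Module.finrank ℂ (FreeTwoStepNilpotent q ⧸ I) = q + pbar →
      Module.finrank ℂ (FreeTwoStepNilpotent q ⧸ Ip) = q + Module.finrank ℂ I) := by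
  obtain ⟨c, h⟩ := free_data q
  have hs : (TwoStepData.BV B).IsRefl := fun v w hvw => (hBsymm _ w.2 _ v.2).trans hvw
  have hIpV : Ip ≤ LieAlgebra.derivedSeries ℂ (FreeTwoStepNilpotent q) 1 :=
    fun v hv => ((hIp v).1 hv).1
  have hJpV : Jp ≤ LieAlgebra.derivedSeries ℂ (FreeTwoStepNilpotent q) 1 :=
    fun v hv => ((hJp v).1 hv).1
  have hI2 := h.dbl hBorth hs hI hIp
  have hJ2 := h.dbl hBorth hs hJ hJp
  refine ⟨?_, ⟨?_, ?_⟩, ?_⟩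
  · have : I = Ipp := by
      ext v
      rw [hI2, hIpp]
    subst this
    exact ⟨LieEquiv.refl⟩
  · rintro ⟨e⟩
    exact h.dual_iso hBorth hBsymm hI hJ hIp hJp e
  · rintro ⟨e⟩
    exact h.dual_iso hBorth hBsymm hIpV hJpV hI2 hJ2 e
  · intro _ _
    exact h.finrank_Ip hBorth hs hI hIp
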